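/- Let C be a 2-identifying code in the square grid G_S and let c = (0,0) ∈ C be a codeword such that (-1,1) ∈ C. Then s_2(C;c) ≤ 35/6. -/

import Mathlib

open scoped Classical

noncomputable section

/-- The ball of radius `r` (in graph distance = l1 distance) around `c` in the square grid. -/
def sqBall (r : ℕ) (c : ℤ × ℤ) : Finset (ℤ × ℤ) :=
  (Finset.Icc (c.1 - r, c.2 - r) (c.1 + r, c.2 + r)).filter
    (fun x => (x.1 - c.1).natAbs + (x.2 - c.2).natAbs ≤ r)

/-- The identifying set `I_r(C;u) = B_r(u) ∩ C`. -/
def iset (r : ℕ) (C : Set (ℤ × ℤ)) (u : ℤ × ℤ) : Finset (ℤ × ℤ) :=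
  (sqBall r u).filter (fun x => x ∈ C)

/-- `C` is an `r`-identifying code in the square grid. -/
def IsIdCode (r : ℕ) (C : Set (ℤ × ℤ)) : Prop :=
  (∀ u, (iset r C u).Nonempty) ∧ ∀ u v : ℤ × ℤ, iset r C u = iset r C v → u = v

/-- The share `s_r(C;c)`. -/
def share (r : ℕ) (C : Set (ℤ × ℤ)) (c : ℤ × ℤ) : ℚ :=
  ∑ u ∈ sqBall r c, (1 : ℚ) / (iset r C u).card

/-- If the identifying sets of the vertices in `S` all contain `K`, then at most one of them
equals `K`, and every other one has at least `K.card + 1` elements. -/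
theorem sum_inv_card_iset_le {r : ℕ} {C : Set (ℤ × ℤ)} (hC : IsIdCode r C)
    {K S : Finset (ℤ × ℤ)} (hK : K.Nonempty) (hS : S.Nonempty)
    (h : ∀ u ∈ S, K ⊆ iset r C u) :
    ∑ u ∈ S, (1 : ℚ) / (iset r C u).card ≤ 1 / K.card + (S.card - 1) / (K.card + 1) := by
  have hk : (0 : ℚ) < K.card := by exact_mod_cast hK.card_pos
  obtain ⟨w, hw, hne⟩ : ∃ w ∈ S, ∀ u ∈ S, u ≠ w → iset r C u ≠ K := by
    by_cases hex : ∃ w ∈ S, iset r C w = K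
    · obtain ⟨w, hw, hwK⟩ := hex
      exact ⟨w, hw, fun u _ huw huK => huw (hC.2 u w (huK.trans hwK.symm))⟩
    · obtain ⟨w, hw⟩ := hS
      exact ⟨w, hw, fun u hu _ huK => hex ⟨u, hu, huK⟩⟩
  rw [← Finset.add_sum_erase S _ hw]
  gcongr
  · exact h w hw
  · have hbound : ∀ u ∈ S.erase w, (1 : ℚ) / (iset r C u).card ≤ 1 / (K.card + 1) := by
      intro u hu
      obtain ⟨huw, huS⟩ := Finset.mem_erase.mp hu
      have hlt : K.card < (iset r C u).card :=
        Finset.card_lt_card ((h u huS).ssubset_of_ne (hne u huS huw).symm)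
      gcongr
      exact_mod_cast hlt
    refine (Finset.sum_le_card_nsmul _ _ _ hbound).trans_eq ?_
    rw [nsmul_eq_mul, Finset.cast_card_erase_of_mem hw, mul_one_div]

theorem mem_iset {r : ℕ} {C : Set (ℤ × ℤ)} {u x : ℤ × ℤ} :
    x ∈ iset r C u ↔ (x.1 - u.1).natAbs + (x.2 - u.2).natAbs ≤ r ∧ x ∈ C := by
  simp only [iset, sqBall, Finset.mem_filter, Finset.mem_Icc, Prod.le_def]
  refine and_congr_left fun _ => and_iff_right_of_imp fun _ => ?_
  omega

/-- The ball of radius two around the origin, split into the vertices within distance two of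
`(-1, 1)` and the remaining ones. -/
theorem sqBall_two_zero :
    sqBall 2 (0, 0) =
      ({(0, 0), (-1, 1), (-1, 0), (0, 1), (1, 1), (-1, -1), (-2, 0), (0, 2)} :
        Finset (ℤ × ℤ)) ∪ {(1, 0), (2, 0), (0, -1), (0, -2), (1, -1)} := by
  ext ⟨a, b⟩
  simp only [sqBall, Finset.mem_filter, Finset.mem_Icc, Prod.mk_le_mk, Finset.mem_union,
    Finset.mem_insert, Finset.mem_singleton, Prod.mk.injEq]
  omega

theorem share_le_of_diagonal_codeword (C : Set (ℤ × ℤ)) (hC : IsIdCode 2 C)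
    (h0 : ((0 : ℤ), (0 : ℤ)) ∈ C) (h1 : ((-1 : ℤ), (1 : ℤ)) ∈ C) :
    share 2 C (0, 0) ≤ 35 / 6 := by
  rw [share, sqBall_two_zero, Finset.sum_union (by simp)]
  have near := sum_inv_card_iset_le hC (K := {(0, 0), (-1, 1)})
    (S := {(0, 0), (-1, 1), (-1, 0), (0, 1), (1, 1), (-1, -1), (-2, 0), (0, 2)})
    (by simp) (by simp) (by simp [Finset.insert_subset_iff, mem_iset, h0, h1])
  have far := sum_inv_card_iset_le hC (K := {(0, 0)})
    (S := {(1, 0), (2, 0), (0, -1), (0, -2), (1, -1)})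
    (by simp) (by simp) (by simp [mem_iset, h0])
  refine (add_le_add near far).trans_eq ?_
  simp [Finset.card_insert_of_notMem]
  norm_num
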